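/- Let b ∈ ℂ, b ≠ 0, and let f : ℂ → ℂ be entire. Define p_k^{(1)} = f^{(k)}(b)/k! and p_k^{(2)} = (−1)^k f^{(k)}(−b)/k! (the Taylor coefficients at t = b of f(t) and of f(−t), respectively). Define f_k^e = (p_k^{(1)} + p_k^{(2)})/2, f_k^o = (p_k^{(1)} − p_k^{(2)})/2, and f_k^{o,e} recursively by b·f_k^{o,e} = f_k^o − f_{k−1}^{o,e} for k ≥ 0, with f_{−1}^{o,e} = 0. Define γ₀ = f₀^e, δ₀ = f₀^{o,e}, and for k ≥ 1: γ_k = Σ_{j=1}^{k} (−1)^{k−j} j (2k−j−1)! / ((2b)^{2k−j} k! (k−j)!) · f_j^e and δ_k = Σ_{j=1}^{k} (−1)^{k−j} j (2k−j−1)! / ((2b)^{2k−j} k! (k−j)!) · f_j^{o,e}. Define γ_k^{(0)} = γ_k, δ_k^{(0)} = δ_k, and for n ≥ 0: γ_k^{(n+1)} = (2k+1)·δ_{k+1}^{(n)} + 2b²(k+1)·δ_{k+2}^{(n)} and δ_k^{(n+1)} = 2(k+1)·γ_{k+2}^{(n)}. Then for every n ≥ 0, αₙ = γ₀^{(n)}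 and βₙ = δ₀^{(n)}, where αₙ, βₙ are the coefficients produced by the Bleistein scheme applied to f₀ = f. -/

import Mathlib

open Complex Finset

/-- **Taylor's theorem** for entire functions, with an entire remainder factor. -/
theorem Differentiable.exists_eq_taylor_add_pow_mul {f : ℂ → ℂ} (hf : Differentiable ℂ f)
    (c : ℂ) (n : ℕ) :
    ∃ h : ℂ → ℂ, Differentiable ℂ h ∧ ∀ t, f t =
      ∑ i ∈ range n, iteratedDeriv i f c / (i.factorial : ℂ) * (t - c) ^ i
        + (t - c) ^ n * h t := by
  have hfc : Differentiable ℂ (fun z => f (c + z)) := by fun_prop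
  obtain ⟨F, hF0, hF⟩ := (hfc.analyticAt 0).exists_eq_sum_add_pow_mul n
  have hFd : Differentiable ℂ F := by
    intro z
    by_cases hz : z = 0
    · exact hz ▸ hF0.differentiableAt
    · have hd : DifferentiableAt ℂ (fun z => (f (c + z) - ∑ i ∈ range n,
          (z ^ i / (i.factorial : ℂ)) • iteratedDeriv i (fun z => f (c + z)) 0) / z ^ n) z := by
        refine DifferentiableAt.div ?_ (by fun_prop) (pow_ne_zero _ hz)
        refine (hfc z).sub ?_
        refine DifferentiableAt.fun_sum fun i _ => ?_
        simp only [smul_eq_mul]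
        fun_prop
      refine hd.congr_of_eventuallyEq ?_
      filter_upwards [isOpen_ne.mem_nhds hz] with y hy
      rw [hF y, add_sub_cancel_left, smul_eq_mul, mul_div_cancel_left₀ _ (pow_ne_zero _ hy)]
  refine ⟨fun t => F (t - c), by fun_prop, fun t => ?_⟩
  have h := hF (t - c)
  simp only [iteratedDeriv_comp_const_add, add_sub_cancel, add_zero, smul_eq_mul] at h
  rw [h]
  congr 1
  exact sum_congr rfl fun i _ => by ring

/-- A function divisible by `(t - b) ^ n` and by `(t + b) ^ n` among entire functions is divisible
by `(t ^ 2 - b ^ 2) ^ n`. -/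
theorem exists_eq_sq_sub_sq_pow_mul {b : ℂ} (hb : b ≠ 0) {F h₁ h₂ : ℂ → ℂ} {n : ℕ}
    (hd₁ : Differentiable ℂ h₁) (hd₂ : Differentiable ℂ h₂)
    (hF₁ : ∀ t, F t = (t - b) ^ n * h₁ t) (hF₂ : ∀ t, F t = (t + b) ^ n * h₂ t) :
    ∃ h : ℂ → ℂ, Differentiable ℂ h ∧ ∀ t, F t = (t ^ 2 - b ^ 2) ^ n * h t := by
  open Polynomial in
  have hcop : IsCoprime ((X - C b : ℂ[X]) ^ n) ((X + C b) ^ n) := by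
    refine IsCoprime.pow ?_
    have h := isCoprime_X_sub_C_of_isUnit_sub (a := b) (b := -b)
      (by simpa using (add_self_eq_zero.not.mpr hb))
    simpa using h
  obtain ⟨P, Q, hPQ⟩ := hcop
  refine ⟨fun t => P.eval t * h₂ t + Q.eval t * h₁ t, by fun_prop, fun t => ?_⟩
  have h := congrArg (Polynomial.eval t) hPQ
  simp only [Polynomial.eval_add, Polynomial.eval_mul, Polynomial.eval_pow, Polynomial.eval_sub,
    Polynomial.eval_X, Polynomial.eval_C, Polynomial.eval_one] at h
  calc F t = (P.eval t * (t - b) ^ n + Q.eval t * (t + b) ^ n) * F t := by rw [h, one_mul]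
    _ = P.eval t * (t - b) ^ n * F t + Q.eval t * (t + b) ^ n * F t := by ring
    _ = P.eval t * (t - b) ^ n * ((t + b) ^ n * h₂ t)
        + Q.eval t * (t + b) ^ n * ((t - b) ^ n * h₁ t) := by rw [← hF₁, ← hF₂]
    _ = _ := by
      rw [show t ^ 2 - b ^ 2 = (t - b) * (t + b) by ring, mul_pow]
      ring

/-- The coefficient of `u ^ k` in the expansion of `w ^ j` in powers of `u = w * (w + 2 * b)`. -/
noncomputable def inversionCoeff (b : ℂ) (k j : ℕ) : ℂ :=
  if k = 0 then (if j = 0 then 1 else 0)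
  else if j ≤ k then
    (-1) ^ (k - j) * (j : ℂ) * ((2 * k - j - 1).factorial : ℂ) /
      ((2 * b) ^ (2 * k - j) * (k.factorial : ℂ) * ((k - j).factorial : ℂ))
  else 0

theorem inversionCoeff_of_lt {b : ℂ} {k j : ℕ} (h : k < j) : inversionCoeff b k j = 0 := by
  unfold inversionCoeff
  split_ifs <;> first | rfl | omega

theorem inversionCoeff_zero_right (b : ℂ) (k : ℕ) :
    inversionCoeff b k 0 = if k = 0 then 1 else 0 := by
  simp [inversionCoeff]

theorem inversionCoeff_succ_self (b : ℂ) (k : ℕ) :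
    inversionCoeff b (k + 1) (k + 1) = 1 / (2 * b) ^ (k + 1) := by
  have h : 2 * (k + 1) - (k + 1) = k + 1 := by omega
  simp only [inversionCoeff, Nat.succ_ne_zero, if_false, le_refl, if_true, h, Nat.sub_self,
    Nat.add_sub_cancel, Nat.factorial_succ, Nat.factorial_zero]
  have h1 : (k.factorial : ℂ) ≠ 0 := by exact_mod_cast k.factorial_ne_zero
  have h2 : (k : ℂ) + 1 ≠ 0 := by exact_mod_cast k.succ_ne_zero
  push_cast
  field_simp

theorem inversionCoeff_add_add_one (b : ℂ) (m j : ℕ) :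
    inversionCoeff b (j + m + 1) j = (-1) ^ (m + 1) * (j : ℂ) * ((j + 2 * m + 1).factorial : ℂ) /
      ((2 * b) ^ (j + 2 * m + 2) * ((j + m + 1).factorial : ℂ) * ((m + 1).factorial : ℂ)) := by
  have h1 : j + m + 1 - j = m + 1 := by omega
  have h2 : 2 * (j + m + 1) - j - 1 = j + 2 * m + 1 := by omega
  have h3 : 2 * (j + m + 1) - j = j + 2 * m + 2 := by omega
  rw [inversionCoeff, if_neg (by omega), if_pos (by omega), h1, h2, h3]

/-- The recurrence reflecting `w ^ (j + 2) + 2 * b * w ^ (j + 1) = u * w ^ j`. -/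
theorem inversionCoeff_recurrence {b : ℂ} (hb : b ≠ 0) (k j : ℕ) :
    inversionCoeff b (k + 1) (j + 2) + 2 * b * inversionCoeff b (k + 1) (j + 1) =
      inversionCoeff b k j := by
  rcases lt_trichotomy k j with h | rfl | h
  · rw [inversionCoeff_of_lt (by omega), inversionCoeff_of_lt (by omega),
      inversionCoeff_of_lt h]
    ring
  · rw [inversionCoeff_of_lt (by omega), inversionCoeff_succ_self]
    cases k with
    | zero => rw [inversionCoeff_zero_right]; simp; field_simp
    | succ k => rw [inversionCoeff_succ_self]; field_simp; ring
  · obtain ⟨m, rfl⟩ : ∃ m, k = j + m + 1 := ⟨k - j - 1, by omega⟩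
    have e := inversionCoeff_add_add_one b m (j + 1)
    rw [show j + 1 + m + 1 = j + m + 1 + 1 by ring,
      show j + 1 + 2 * m + 1 = j + 2 * m + 1 + 1 by ring,
      show j + 1 + 2 * m + 2 = j + 2 * m + 3 by ring] at e
    have e' : inversionCoeff b (j + m + 1 + 1) (j + 2) =
        (-1) ^ m * ((j : ℂ) + 2) * ((j + 2 * m + 1).factorial : ℂ) /
          ((2 * b) ^ (j + 2 * m + 2) * ((j + m + 1 + 1).factorial : ℂ) * (m.factorial : ℂ)) := by
      have h1 : j + m + 1 + 1 - (j + 2) = m := by omega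
      have h2 : 2 * (j + m + 1 + 1) - (j + 2) - 1 = j + 2 * m + 1 := by omega
      have h3 : 2 * (j + m + 1 + 1) - (j + 2) = j + 2 * m + 2 := by omega
      rw [inversionCoeff, if_neg (by omega), if_pos (by omega), h1, h2, h3]
      push_cast
      rfl
    rw [e, e', inversionCoeff_add_add_one, Nat.factorial_succ (j + m + 1),
      Nat.factorial_succ (j + 2 * m + 1), Nat.factorial_succ m]
    have f1 : ((j + m + 1).factorial : ℂ) ≠ 0 := by exact_mod_cast Nat.factorial_ne_zero _
    have f2 : ((j + 2 * m + 1).factorial : ℂ) ≠ 0 := by exact_mod_cast Nat.factorial_ne_zero _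
    have f3 : (m.factorial : ℂ) ≠ 0 := by exact_mod_cast Nat.factorial_ne_zero _
    have f4 : (m : ℂ) + 1 ≠ 0 := by exact_mod_cast m.succ_ne_zero
    have f5 : (j : ℂ) + m + 1 + 1 ≠ 0 := by exact_mod_cast (j + m + 1).succ_ne_zero
    have f6 : (2 * b) ^ (j + 2 * m + 2) ≠ 0 := pow_ne_zero _ (by simpa using hb)
    rw [show (2 * b) ^ (j + 2 * m + 3) = (2 * b) ^ (j + 2 * m + 2) * (2 * b) from pow_succ _ _]
    generalize (2 * b) ^ (j + 2 * m + 2) = B at *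
    push_cast
    rw [pow_succ]
    field_simp
    ring

open Polynomial in
/-- The polynomials in `u = w * (w + 2 * b)` with coefficients `inversionCoeff b k j` approximate
`w ^ j` to any order. -/
theorem X_pow_dvd_sum_inversionCoeff_sub {b : ℂ} (hb : b ≠ 0) (n j : ℕ) :
    (X : ℂ[X]) ^ n ∣
      ∑ k ∈ range n, C (inversionCoeff b k j) * (X * (X + C (2 * b))) ^ k - X ^ j := by
  induction n generalizing j with
  | zero => simp
  | succ n ih =>
    set D : ℕ → ℂ[X] := fun j =>
      ∑ k ∈ range (n + 1), C (inversionCoeff b k j) * (X * (X + C (2 * b))) ^ k - X ^ j with hD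
    have hrec : ∀ j, D (j + 2) + C (2 * b) * D (j + 1) = (X * (X + C (2 * b))) *
        (∑ k ∈ range n, C (inversionCoeff b k j) * (X * (X + C (2 * b))) ^ k - X ^ j) := by
      intro j
      have hsplit : ∀ j, D (j + 1) = ∑ k ∈ range n,
          C (inversionCoeff b (k + 1) (j + 1)) * (X * (X + C (2 * b))) ^ (k + 1)
            - X ^ (j + 1) := fun j => by
        simp only [hD, sum_range_succ', inversionCoeff_of_lt (Nat.succ_pos j), map_zero,
          zero_mul, add_zero]
      have hsum : ∑ k ∈ range n, X * (X + C (2 * b)) *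
            (C (inversionCoeff b k j) * (X * (X + C (2 * b))) ^ k) =
          ∑ k ∈ range n, C (inversionCoeff b (k + 1) (j + 2)) * (X * (X + C (2 * b))) ^ (k + 1) +
          ∑ k ∈ range n, C (2 * b) *
            (C (inversionCoeff b (k + 1) (j + 1)) * (X * (X + C (2 * b))) ^ (k + 1)) := by
        rw [← sum_add_distrib]
        refine sum_congr rfl fun k _ => ?_
        rw [← inversionCoeff_recurrence hb k j, C_add, C_mul (a := 2 * b)]
        ring
      rw [hsplit (j + 1), hsplit j, mul_sub, mul_sum, mul_sub, mul_sum, hsum]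
      ring
    have hdiv : ∀ m j, n + 1 ≤ j + 1 + m → X ^ (n + 1) ∣ D (j + 1) := by
      intro m
      induction m with
      | zero =>
        intro j hj
        have h0 : D (j + 1) = -X ^ (j + 1) := by
          simp only [hD]
          rw [sum_eq_zero, zero_sub]
          intro k hk
          rw [inversionCoeff_of_lt (by have := mem_range.mp hk; omega), map_zero, zero_mul]
        rw [h0, dvd_neg]
        exact pow_dvd_pow _ (by omega)
      | succ m ihm =>
        intro j hj
        have h1 : X ^ (n + 1) ∣ D (j + 2) + C (2 * b) * D (j + 1) := by
          rw [hrec, pow_succ']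
          exact mul_dvd_mul (dvd_mul_right _ _) (ih j)
        have h2 := (dvd_add_right (ihm (j + 1) (by omega))).mp h1
        have hu : IsUnit (C (2 * b)) := isUnit_C.mpr (by simpa using hb)
        exact hu.dvd_mul_left.mp h2
    cases j with
    | zero => simp [inversionCoeff_zero_right, apply_ite C, ite_mul, sum_ite_eq']
    | succ j => exact hdiv (n + 1) j (by omega)

/-- Re-expansion of a power series in `w` as a power series in `u = w * (w + 2 * b)`, with a
polynomial remainder. -/
theorem exists_sum_inversionCoeff_eq {b : ℂ} (hb : b ≠ 0) {e c : ℕ → ℂ}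
    (hc : ∀ k, c k = ∑ j ∈ range (k + 1), inversionCoeff b k j * e j) (n : ℕ) :
    ∃ Q : Polynomial ℂ, ∀ w : ℂ, ∑ k ∈ range n, c k * (w * (w + 2 * b)) ^ k =
      ∑ j ∈ range n, e j * w ^ j + w ^ n * Q.eval w := by
  choose q hq using fun j => X_pow_dvd_sum_inversionCoeff_sub hb n j
  refine ⟨∑ j ∈ range n, Polynomial.C (e j) * q j, fun w => ?_⟩
  have hqw : ∀ j, ∑ k ∈ range n, inversionCoeff b k j * (w * (w + 2 * b)) ^ k =
      w ^ j + w ^ n * (q j).eval w := by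
    intro j
    have h := congrArg (Polynomial.eval w) (hq j)
    simp only [Polynomial.eval_sub, Polynomial.eval_finsetSum, Polynomial.eval_mul,
      Polynomial.eval_pow, Polynomial.eval_add, Polynomial.eval_X, Polynomial.eval_C] at h
    linear_combination h
  have hcn : ∀ k ∈ range n, c k = ∑ j ∈ range n, inversionCoeff b k j * e j := by
    intro k hk
    rw [hc k]
    refine sum_subset (range_subset_range.mpr (mem_range.mp hk)) fun j _ hj => ?_
    rw [inversionCoeff_of_lt (by simpa using hj), zero_mul]
  calc ∑ k ∈ range n, c k * (w * (w + 2 * b)) ^ k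
      = ∑ k ∈ range n, ∑ j ∈ range n,
          e j * (inversionCoeff b k j * (w * (w + 2 * b)) ^ k) := by
        refine sum_congr rfl fun k hk => ?_
        rw [hcn k hk, sum_mul]
        exact sum_congr rfl fun j _ => by ring
    _ = ∑ j ∈ range n, e j * (w ^ j + w ^ n * (q j).eval w) := by
        rw [sum_comm]
        exact sum_congr rfl fun j _ => by rw [← mul_sum, hqw]
    _ = _ := by
        simp only [Polynomial.eval_finsetSum, Polynomial.eval_mul, Polynomial.eval_C, mul_add,
          sum_add_distrib, mul_sum]
        congr 1
        exact sum_congr rfl fun j _ => by ring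

/-- `c` is obtained from `e` by the explicit formula for `γ` and `δ`. -/
theorem eq_sum_inversionCoeff {b : ℂ} {e c : ℕ → ℂ} (h0 : c 0 = e 0)
    (hc : ∀ k, 1 ≤ k → c k = ∑ j ∈ Icc 1 k,
      ((-1) ^ (k - j) * (j : ℂ) * ((2 * k - j - 1).factorial : ℂ) /
        ((2 * b) ^ (2 * k - j) * (k.factorial : ℂ) * ((k - j).factorial : ℂ))) * e j) (k : ℕ) :
    c k = ∑ j ∈ range (k + 1), inversionCoeff b k j * e j := by
  rcases Nat.eq_zero_or_pos k with rfl | hk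
  · simp [h0, inversionCoeff]
  · rw [hc k hk]
    refine (sum_congr rfl fun j hj => ?_).trans
      (sum_subset (s₂ := range (k + 1)) (fun j hj => ?_) fun j hj hj' => ?_)
    · rw [inversionCoeff, if_neg hk.ne', if_pos (mem_Icc.mp hj).2]
    · simp only [mem_Icc, mem_range] at hj ⊢
      omega
    · simp only [mem_Icc, mem_range] at hj hj'
      obtain rfl : j = 0 := by omega
      rw [inversionCoeff_zero_right, if_neg hk.ne', zero_mul]

/-- The two-point Taylor expansion with coefficients `c k + d k * t`: for every `n`, the function
`f` agrees with its truncation up to an entire multiple of `(t ^ 2 - b ^ 2) ^ n`. -/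
def HasTwoPointExpansion (b : ℂ) (f : ℂ → ℂ) (c d : ℕ → ℂ) : Prop :=
  ∀ n, ∃ h : ℂ → ℂ, Differentiable ℂ h ∧ ∀ t, f t =
    ∑ k ∈ range n, (c k + d k * t) * (t ^ 2 - b ^ 2) ^ k + (t ^ 2 - b ^ 2) ^ n * h t

theorem hasTwoPointExpansion_of_taylor {b : ℂ} (hb : b ≠ 0) {f : ℂ → ℂ} (hf : Differentiable ℂ f)
    {e o c d : ℕ → ℂ}
    (hp : ∀ k, iteratedDeriv k f b / (k.factorial : ℂ) =
      e k + (b * o k + if k = 0 then 0 else o (k - 1)))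
    (hm : ∀ k, (-1) ^ k * iteratedDeriv k f (-b) / (k.factorial : ℂ) =
      e k - (b * o k + if k = 0 then 0 else o (k - 1)))
    (hc : ∀ k, c k = ∑ j ∈ range (k + 1), inversionCoeff b k j * e j)
    (hd : ∀ k, d k = ∑ j ∈ range (k + 1), inversionCoeff b k j * o j) :
    HasTwoPointExpansion b f c d := by
  intro n
  obtain ⟨h₁, hd₁, hf₁⟩ := hf.exists_eq_taylor_add_pow_mul b n
  obtain ⟨h₂, hd₂, hf₂⟩ := hf.exists_eq_taylor_add_pow_mul (-b) n
  obtain ⟨P, hP⟩ := exists_sum_inversionCoeff_eq hb hc n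
  obtain ⟨Q, hQ⟩ := exists_sum_inversionCoeff_eq hb hd n
  have hshift : ∃ r : ℂ, ∀ w : ℂ,
      ∑ k ∈ range n, (b * o k + if k = 0 then 0 else o (k - 1)) * w ^ k =
        (b + w) * ∑ k ∈ range n, o k * w ^ k - w ^ n * r := by
    cases n with
    | zero => exact ⟨0, by simp⟩
    | succ m =>
      refine ⟨o m, fun w => ?_⟩
      simp only [add_mul, sum_add_distrib]
      rw [sum_range_succ' (fun k => (if k = 0 then 0 else o (k - 1)) * w ^ k),
        sum_range_succ (fun k => o k * w ^ k), mul_add]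
      simp only [Nat.succ_ne_zero, if_false, Nat.add_sub_cancel, if_true, zero_mul, add_zero,
        sum_range_succ (fun k => b * o k * w ^ k)]
      have e1 : ∀ k, o k * w ^ (k + 1) = w * (o k * w ^ k) := fun k => by ring
      simp only [e1, mul_assoc b, ← mul_sum]
      ring
  obtain ⟨r, hr⟩ := hshift
  have hsum : ∀ t : ℂ, ∑ k ∈ range n, (c k + d k * t) * (t ^ 2 - b ^ 2) ^ k =
      ∑ k ∈ range n, c k * (t ^ 2 - b ^ 2) ^ k + t * ∑ k ∈ range n, d k * (t ^ 2 - b ^ 2) ^ k := by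
    intro t
    rw [mul_sum, ← sum_add_distrib]
    exact sum_congr rfl fun k _ => by ring
  have hF₁ : ∀ t, f t - ∑ k ∈ range n, (c k + d k * t) * (t ^ 2 - b ^ 2) ^ k =
      (t - b) ^ n * (h₁ t - r - P.eval (t - b) - t * Q.eval (t - b)) := by
    intro t
    have h1 := hP (t - b)
    have h2 := hQ (t - b)
    rw [show (t - b) * (t - b + 2 * b) = t ^ 2 - b ^ 2 by ring] at h1 h2
    have h3 := hr (t - b)
    have h4 : ∑ i ∈ range n, iteratedDeriv i f b / (i.factorial : ℂ) * (t - b) ^ i =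
        ∑ i ∈ range n, e i * (t - b) ^ i +
        ∑ k ∈ range n, (b * o k + if k = 0 then 0 else o (k - 1)) * (t - b) ^ k := by
      rw [← sum_add_distrib]
      exact sum_congr rfl fun k _ => by rw [hp]; ring
    simp only [hsum, hf₁ t, h1, h2, h4, h3]
    ring
  have hF₂ : ∀ t, f t - ∑ k ∈ range n, (c k + d k * t) * (t ^ 2 - b ^ 2) ^ k =
      (t + b) ^ n * (h₂ t + (-1) ^ n * (r - P.eval (-t - b) - t * Q.eval (-t - b))) := by
    intro t
    have h1 := hP (-t - b)
    have h2 := hQ (-t - b)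
    rw [show (-t - b) * (-t - b + 2 * b) = t ^ 2 - b ^ 2 by ring] at h1 h2
    have h3 := hr (-t - b)
    have hneg : ∀ i, (t - -b) ^ i = (-1) ^ i * (-t - b) ^ i := fun i => by
      rw [← mul_pow]; ring
    have h4 : ∑ i ∈ range n, iteratedDeriv i f (-b) / (i.factorial : ℂ) * (t - -b) ^ i =
        ∑ i ∈ range n, e i * (-t - b) ^ i -
        ∑ k ∈ range n, (b * o k + if k = 0 then 0 else o (k - 1)) * (-t - b) ^ k := by
      rw [← sum_sub_distrib]
      exact sum_congr rfl fun k _ => by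
        rw [hneg, ← sub_mul, ← hm]
        ring
    have h5 : (-t - b) ^ n = (-1) ^ n * (t + b) ^ n := by rw [← mul_pow]; ring
    rw [hsum, hf₂ t, h1, h2, h4, h3, h5]
    ring
  obtain ⟨h, hh, hfh⟩ := exists_eq_sq_sub_sq_pow_mul hb (by fun_prop) (by fun_prop) hF₁ hF₂
  exact ⟨h, hh, fun t => by rw [← hfh t]; ring⟩

/-- The termwise derivative of a truncated two-point Taylor expansion. -/
theorem hasDerivAt_sum_twoPoint (b : ℂ) (c d : ℕ → ℂ) (n : ℕ) (t : ℂ) :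
    HasDerivAt (fun t => ∑ k ∈ range (n + 1), (c (k + 1) + d (k + 1) * t) * (t ^ 2 - b ^ 2) ^ k)
      (∑ k ∈ range n, (((2 * (k : ℂ) + 1) * d (k + 1) + 2 * b ^ 2 * ((k : ℂ) + 1) * d (k + 2))
        + 2 * ((k : ℂ) + 1) * c (k + 2) * t) * (t ^ 2 - b ^ 2) ^ k
        + (t ^ 2 - b ^ 2) ^ n * ((2 * (n : ℂ) + 1) * d (n + 1))) t := by
  have hu : HasDerivAt (fun t : ℂ => t ^ 2 - b ^ 2) (2 * t) t := by
    simpa using (hasDerivAt_pow 2 t).sub_const (b ^ 2)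
  have hl : ∀ k, HasDerivAt (fun t => c k + d k * t) (d k) t := fun k => by
    simpa using ((hasDerivAt_id t).const_mul (d k)).const_add (c k)
  induction n with
  | zero => simpa using hl 1
  | succ n ih =>
    simp only [sum_range_succ _ (n + 1)]
    convert! ih.add ((hl (n + 2)).mul (hu.pow (n + 1))) using 1
    rw [sum_range_succ]
    push_cast
    simp only [Pi.pow_apply, pow_succ (t ^ 2 - b ^ 2) n]
    ring

namespace HasTwoPointExpansion

variable {b : ℂ} {f g : ℂ → ℂ} {c d : ℕ → ℂ}

theorem coeff_zero (hb : b ≠ 0) (h : HasTwoPointExpansion b f c d) :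
    (f b + f (-b)) / 2 = c 0 ∧ (f b - f (-b)) / (2 * b) = d 0 := by
  obtain ⟨r, -, hr⟩ := h 1
  rw [hr b, hr (-b)]
  simp only [sum_range_one]
  constructor
  · ring
  · field_simp
    ring

/-- Division by `t ^ 2 - b ^ 2` followed by differentiation acts on the coefficients of a two-point
Taylor expansion by the recursion of the coefficient algorithm. -/
theorem deriv_quotient (h : HasTwoPointExpansion b f c d) (hg : Differentiable ℂ g)
    (hfg : ∀ t, f t = (c 0 + d 0 * t) + (t ^ 2 - b ^ 2) * g t) :
    HasTwoPointExpansion b (deriv g)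
      (fun k => (2 * (k : ℂ) + 1) * d (k + 1) + 2 * b ^ 2 * ((k : ℂ) + 1) * d (k + 2))
      (fun k => 2 * ((k : ℂ) + 1) * c (k + 2)) := by
  intro n
  obtain ⟨r, hr, hfr⟩ := h (n + 2)
  set G : ℂ → ℂ := fun t =>
    ∑ k ∈ range (n + 1), (c (k + 1) + d (k + 1) * t) * (t ^ 2 - b ^ 2) ^ k
      + (t ^ 2 - b ^ 2) ^ (n + 1) * r t with hG
  have hmul : ∀ t, (t ^ 2 - b ^ 2) * g t = (t ^ 2 - b ^ 2) * G t := by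
    intro t
    have h1 := hfr t
    rw [hfg t, sum_range_succ'] at h1
    simp only [hG]
    rw [mul_add, mul_sum]
    have e1 : ∀ k, (t ^ 2 - b ^ 2) * ((c (k + 1) + d (k + 1) * t) * (t ^ 2 - b ^ 2) ^ k) =
        (c (k + 1) + d (k + 1) * t) * (t ^ 2 - b ^ 2) ^ (k + 1) := fun k => by ring
    have e2 : ∀ t : ℂ, (t ^ 2 - b ^ 2) * ((t ^ 2 - b ^ 2) ^ (n + 1) * r t) =
        (t ^ 2 - b ^ 2) ^ (n + 2) * r t := fun t => by ring
    rw [e2]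
    simp only [e1]
    linear_combination h1
  have hGc : Continuous G := by
    have := hr.continuous
    fun_prop
  have hgG : g = G := by
    refine Continuous.ext_on (s := {b, -b}ᶜ) ?_ hg.continuous hGc fun t ht => ?_
    · exact (Set.toFinite _).countable.dense_compl ℂ
    · simp only [Set.mem_compl_iff, Set.mem_insert_iff, Set.mem_singleton_iff, not_or] at ht
      refine mul_left_cancel₀ ?_ (hmul t)
      rw [sub_ne_zero]
      exact fun h => (sq_eq_sq_iff_eq_or_eq_neg.mp h).elim ht.1 ht.2
  refine ⟨fun t => (2 * (n : ℂ) + 1) * d (n + 1) + (n + 1) * (2 * t) * r t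
    + (t ^ 2 - b ^ 2) * deriv r t, ?_, fun t => ?_⟩
  · have := hr.deriv
    fun_prop
  · have hu : HasDerivAt (fun t : ℂ => t ^ 2 - b ^ 2) (2 * t) t := by
      simpa using (hasDerivAt_pow 2 t).sub_const (b ^ 2)
    have hder := (hasDerivAt_sum_twoPoint b c d n t).add
      ((hu.pow (n + 1)).mul (hr t).hasDerivAt)
    rw [hgG]
    refine hder.deriv.trans ?_
    push_cast
    simp only [Pi.pow_apply]
    ring

end HasTwoPointExpansion

/-- The coefficient algorithm: the coefficients `αₙ, βₙ` of the Bleistein scheme applied to an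
entire function `f₀ = f 0` are computed from the Taylor coefficients `p_k^{(1)}, p_k^{(2)}`
of `f(t)` and `f(−t)` at `t = b` via the quantities `f_k^e, f_k^o, f_k^{o,e}, γ_k, δ_k,
γ_k^{(n)}, δ_k^{(n)}`. -/
theorem bleistein_coefficient_algorithm
    (b : ℂ) (hb : b ≠ 0)
    (f g : ℕ → ℂ → ℂ) (α β : ℕ → ℂ)
    (hf : ∀ n, Differentiable ℂ (f n))
    (hg : ∀ n, Differentiable ℂ (g n))
    (hα : ∀ n, α n = (f n b + f n (-b)) / 2)
    (hβ : ∀ n, β n = (f n b - f n (-b)) / (2 * b))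
    (hdecomp : ∀ n, ∀ t : ℂ, f n t = α n + β n * t + (t ^ 2 - b ^ 2) * g n t)
    (hstep : ∀ n, f (n + 1) = deriv (g n))
    (p₁ p₂ fe fo foe γ δ : ℕ → ℂ) (Γ Δ : ℕ → ℕ → ℂ)
    (hp₁ : ∀ k, p₁ k = iteratedDeriv k (f 0) b / (k.factorial : ℂ))
    (hp₂ : ∀ k, p₂ k = (-1) ^ k * iteratedDeriv k (f 0) (-b) / (k.factorial : ℂ))
    (hfe : ∀ k, fe k = (p₁ k + p₂ k) / 2)
    (hfo : ∀ k, fo k = (p₁ k - p₂ k) / 2)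
    (hfoe0 : b * foe 0 = fo 0)
    (hfoeS : ∀ k, b * foe (k + 1) = fo (k + 1) - foe k)
    (hγ0 : γ 0 = fe 0)
    (hδ0 : δ 0 = foe 0)
    (hγ : ∀ k, 1 ≤ k → γ k = ∑ j ∈ Icc 1 k,
      ((-1) ^ (k - j) * (j : ℂ) * ((2 * k - j - 1).factorial : ℂ) /
        ((2 * b) ^ (2 * k - j) * (k.factorial : ℂ) * ((k - j).factorial : ℂ))) * fe j)
    (hδ : ∀ k, 1 ≤ k → δ k = ∑ j ∈ Icc 1 k,
      ((-1) ^ (k - j) * (j : ℂ) * ((2 * k - j - 1).factorial : ℂ) /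
        ((2 * b) ^ (2 * k - j) * (k.factorial : ℂ) * ((k - j).factorial : ℂ))) * foe j)
    (hΓ0 : ∀ k, Γ 0 k = γ k)
    (hΔ0 : ∀ k, Δ 0 k = δ k)
    (hΓS : ∀ n k, Γ (n + 1) k =
      (2 * (k : ℂ) + 1) * Δ n (k + 1) + 2 * b ^ 2 * ((k : ℂ) + 1) * Δ n (k + 2))
    (hΔS : ∀ n k, Δ (n + 1) k = 2 * ((k : ℂ) + 1) * Γ n (k + 2)) :
    ∀ n : ℕ, α n = Γ n 0 ∧ β n = Δ n 0 := by
  have hfoe : ∀ k, fo k = b * foe k + if k = 0 then 0 else foe (k - 1) := by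
    intro k
    cases k with
    | zero => simp [hfoe0]
    | succ k => simp [hfoeS]
  have hexp : ∀ n, HasTwoPointExpansion b (f n) (Γ n) (Δ n) := by
    intro n
    induction n with
    | zero =>
      rw [funext hΓ0, funext hΔ0]
      refine hasTwoPointExpansion_of_taylor hb (hf 0) (fun k => ?_) (fun k => ?_)
        (eq_sum_inversionCoeff hγ0 hγ) (eq_sum_inversionCoeff hδ0 hδ)
      · rw [← hfoe, ← hp₁, hfe, hfo]
        ring
      · rw [← hfoe, ← hp₂, hfe, hfo]
        ring
    | succ n ih =>
      have h0 := ih.coeff_zero hb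
      rw [← hα, ← hβ] at h0
      rw [hstep, funext (hΓS n), funext (hΔS n)]
      exact ih.deriv_quotient (hg n) fun t => by rw [← h0.1, ← h0.2, hdecomp]
  intro n
  rw [hα, hβ]
  exact (hexp n).coeff_zero hb
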